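/- There is a constant c > 0 such that the following holds. Let G = (V, E) be a finite simple graph with m ≥ 1 edges. Construct H' from G by, for each edge ij ∈ E, adding two new vertices q_{ij} and t_{ij} and edges so that {i, j, q_{ij}, t_{ij}} forms a 4-clique. Construct H'' from H' by, for each edge uv of H', adding a new vertex r_{uv} together with edges u·r_{uv} and v·r_{uv} (so each edge of H' lies in a 3-clique); finally add a single new sink vertex t and an edge t·t_{ij} for every ij ∈ E. If MC₃(H'') ≥ (10 + 2√3)·m + m − c/m², then G is 3-colorable. -/

import Mathlib

open scoped Classical

/-- The Euclidean norm on `Fin 3 → ℝ`. -/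
noncomputable def norm3 (v : Fin 3 → ℝ) : ℝ := Real.sqrt (∑ i, v i ^ 2)

/-- The rank-3 max-cut value of a finite simple graph:
`(1/4) maxₓ ∑_{uv ∈ E} ‖x(u) - x(v)‖²` over assignments of unit vectors in `ℝ³` to the
vertices (each unordered edge is counted twice in the double sum, whence the `1/8`). -/
noncomputable def mc3 {V : Type} [Fintype V] (G : SimpleGraph V) : ℝ :=
  sSup {c : ℝ | ∃ x : V → Fin 3 → ℝ, (∀ u, norm3 (x u) = 1) ∧
    c = (1 / 8) * ∑ u, ∑ v,
      if G.Adj u v then (norm3 (x u - x v)) ^ 2 else 0}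

/-- The graph `H'` obtained from `G` by adding, for each edge `ij ∈ E`, two new
vertices `q_{ij}`, `t_{ij}` forming a 4-clique `{i, j, q_{ij}, t_{ij}}`. -/
def cliqueGadget {V : Type} (G : SimpleGraph V) :
    SimpleGraph (V ⊕ (G.edgeSet ⊕ G.edgeSet)) :=
  SimpleGraph.fromRel fun a b =>
    match a, b with
    | Sum.inl u, Sum.inl v => G.Adj u v
    | Sum.inl u, Sum.inr (Sum.inl e) => u ∈ (e : Sym2 V)
    | Sum.inl u, Sum.inr (Sum.inr e) => u ∈ (e : Sym2 V)
    | Sum.inr (Sum.inl e), Sum.inr (Sum.inr e') => (e : Sym2 V) = (e' : Sym2 V)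
    | _, _ => False

/-- The graph `H''` obtained from `H' = cliqueGadget G` by adding, for each edge `uv`
of `H'`, a new vertex `r_{uv}` adjacent to both `u` and `v`, and finally a sink
vertex `t` adjacent to every `t_{ij}`. -/
def tetraGadget {V : Type} (G : SimpleGraph V) :
    SimpleGraph (((V ⊕ (G.edgeSet ⊕ G.edgeSet)) ⊕ (cliqueGadget G).edgeSet) ⊕ Unit) :=
  SimpleGraph.fromRel fun a b =>
    match a, b with
    | Sum.inl (Sum.inl x), Sum.inl (Sum.inl y) => (cliqueGadget G).Adj x y
    | Sum.inl (Sum.inl x), Sum.inl (Sum.inr e) =>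
        x ∈ (e : Sym2 (V ⊕ (G.edgeSet ⊕ G.edgeSet)))
    | Sum.inl (Sum.inl (Sum.inr (Sum.inr _))), Sum.inr _ => True
    | _, _ => False

/-- dot product -/
noncomputable def dt (u v : Fin 3 → ℝ) : ℝ := u 0 * v 0 + u 1 * v 1 + u 2 * v 2

lemma norm3_nonneg (v : Fin 3 → ℝ) : 0 ≤ norm3 v := Real.sqrt_nonneg _

lemma norm3_sq (v : Fin 3 → ℝ) : norm3 v ^ 2 = dt v v := by
  unfold norm3 dt
  rw [Real.sq_sqrt (Finset.sum_nonneg fun i _ => sq_nonneg _), Fin.sum_univ_three]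
  ring

lemma dt_self_of_unit {v : Fin 3 → ℝ} (h : norm3 v = 1) : dt v v = 1 := by
  rw [← norm3_sq, h]; norm_num

lemma dt_sq_le (u v : Fin 3 → ℝ) : dt u v ^ 2 ≤ dt u u * dt v v := by
  unfold dt
  nlinarith [sq_nonneg (u 0 * v 1 - u 1 * v 0), sq_nonneg (u 0 * v 2 - u 2 * v 0),
    sq_nonneg (u 1 * v 2 - u 2 * v 1)]

lemma abs_dt_le {u : Fin 3 → ℝ} (hu : norm3 u = 1) (v : Fin 3 → ℝ) : |dt u v| ≤ norm3 v := by
  apply abs_le_of_sq_le_sq _ (norm3_nonneg v)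
  have := dt_sq_le u v
  rw [dt_self_of_unit hu] at this
  rw [norm3_sq]; linarith

lemma sub_sq3 (u v : Fin 3 → ℝ) : norm3 (u - v) ^ 2 = dt u u + dt v v - 2 * dt u v := by
  rw [norm3_sq]; simp only [dt, Pi.sub_apply]; ring

lemma add_sq3 (u v : Fin 3 → ℝ) : norm3 (u + v) ^ 2 = dt u u + dt v v + 2 * dt u v := by
  rw [norm3_sq]; simp only [dt, Pi.add_apply]; ring

lemma norm3_sub_comm (u v : Fin 3 → ℝ) : norm3 (u - v) = norm3 (v - u) := by
  unfold norm3; congr 1; apply Finset.sum_congr rfl; intro i _; simp only [Pi.sub_apply]; ring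

lemma dt_comm (u v : Fin 3 → ℝ) : dt u v = dt v u := by unfold dt; ring

/-- value of an edge with its adjoined triangle, times four -/
noncomputable def psi (u v : Fin 3 → ℝ) : ℝ := norm3 (u - v) ^ 2 + 4 + 2 * norm3 (u + v)

lemma psi_comm (u v : Fin 3 → ℝ) : psi u v = psi v u := by
  unfold psi; rw [norm3_sub_comm, add_comm u v]

lemma tri_le {u v r : Fin 3 → ℝ} (hu : norm3 u = 1) (hv : norm3 v = 1) (hr : norm3 r = 1) :
    norm3 (u - r) ^ 2 + norm3 (v - r) ^ 2 ≤ 4 + 2 * norm3 (u + v) := by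
  have h := (abs_le.1 (abs_dt_le hr (u + v))).1
  have h2 : dt r (u + v) = dt u r + dt v r := by simp only [dt, Pi.add_apply]; ring
  rw [sub_sq3, sub_sq3, dt_self_of_unit hu, dt_self_of_unit hv, dt_self_of_unit hr]
  linarith

lemma psi_eq {u v : Fin 3 → ℝ} (hu : norm3 u = 1) (hv : norm3 v = 1) :
    psi u v + √3 / 2 * (norm3 (u + v) - 2 * √3 / 3) ^ 2 =
      8 - (1 - √3 / 2) * norm3 (u + v) ^ 2 + 2 * √3 / 3 := by
  have h3 : √3 ^ 2 = 3 := Real.sq_sqrt (by norm_num)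
  have h1 := sub_sq3 u v
  have h2 := add_sq3 u v
  rw [dt_self_of_unit hu, dt_self_of_unit hv] at h1 h2
  unfold psi
  have : norm3 (u - v) ^ 2 = 4 - norm3 (u + v) ^ 2 := by linarith
  rw [this]
  generalize norm3 (u + v) = s
  generalize √3 = k at *
  linear_combination (-2 / 3 * s + 2 / 9 * k) * h3

lemma gadget {a b c d : Fin 3 → ℝ} (ha : norm3 a = 1) (hb : norm3 b = 1) (hc : norm3 c = 1)
    (hd : norm3 d = 1) :
    psi a b + psi a c + psi b c + psi a d + psi b d + psi c d +
      √3 / 2 * ((norm3 (a + b) - 2 * √3 / 3) ^ 2 + (norm3 (a + d) - 2 * √3 / 3) ^ 2 +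
        (norm3 (b + d) - 2 * √3 / 3) ^ 2) ≤ 40 + 8 * √3 := by
  have h3 : √3 ^ 2 = 3 := Real.sq_sqrt (by norm_num)
  have hk : √3 ≤ 2 := by rw [Real.sqrt_le_left (by norm_num)]; norm_num
  have hk0 : 0 ≤ √3 := Real.sqrt_nonneg _
  have e1 := psi_eq ha hb
  have e2 := psi_eq ha hc
  have e3 := psi_eq hb hc
  have e4 := psi_eq ha hd
  have e5 := psi_eq hb hd
  have e6 := psi_eq hc hd
  have p2 : 0 ≤ √3 / 2 * (norm3 (a + c) - 2 * √3 / 3) ^ 2 := by positivity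
  have p3 : 0 ≤ √3 / 2 * (norm3 (b + c) - 2 * √3 / 3) ^ 2 := by positivity
  have p6 : 0 ≤ √3 / 2 * (norm3 (c + d) - 2 * √3 / 3) ^ 2 := by positivity
  have hs : 8 ≤ norm3 (a + b) ^ 2 + norm3 (a + c) ^ 2 + norm3 (b + c) ^ 2 + norm3 (a + d) ^ 2
      + norm3 (b + d) ^ 2 + norm3 (c + d) ^ 2 := by
    have := norm3_sq (a + b + c + d)
    have hn := sq_nonneg (norm3 (a + b + c + d))
    have hx : dt (a + b + c + d) (a + b + c + d) = dt a a + dt b b + dt c c + dt d d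
      + 2 * (dt a b + dt a c + dt b c + dt a d + dt b d + dt c d) := by
      simp only [dt, Pi.add_apply]; ring
    simp only [add_sq3]
    rw [dt_self_of_unit ha, dt_self_of_unit hb, dt_self_of_unit hc, dt_self_of_unit hd] at *
    linarith
  have := mul_nonneg (by linarith : 0 ≤ 1 - √3 / 2) (sub_nonneg.2 hs)
  linarith

lemma dot_close {u v : Fin 3 → ℝ} (hu : norm3 u = 1) (hv : norm3 v = 1) {η : ℝ} (hη : 0 ≤ η)
    (h : √3 / 2 * (norm3 (u + v) - 2 * √3 / 3) ^ 2 ≤ 4 * η ^ 2) : |dt u v + 1 / 3| ≤ 5 * η := by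
  have h3 : √3 ^ 2 = 3 := Real.sq_sqrt (by norm_num)
  have hk : √3 ≤ 2 := by rw [Real.sqrt_le_left (by norm_num)]; norm_num
  have hk1 : (1.7 : ℝ) ≤ √3 := by apply Real.le_sqrt_of_sq_le; norm_num
  have h2 := add_sq3 u v
  have hd := abs_le.1 (abs_dt_le hu v)
  rw [hv] at hd
  rw [dt_self_of_unit hu, dt_self_of_unit hv] at h2
  have h0 := norm3_nonneg (u + v)
  set s := norm3 (u + v)
  have hs : s ≤ 2 := by nlinarith
  have hsq : (s - 2 * √3 / 3) ^ 2 ≤ 5 * η ^ 2 := by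
    nlinarith [sq_nonneg (s - 2 * √3 / 3), sq_nonneg η]
  have hq : dt u v + 1 / 3 = (s - 2 * √3 / 3) * ((s + 2 * √3 / 3) / 2) := by
    linear_combination -h2 / 2 + 2 / 9 * h3
  apply abs_le_of_sq_le_sq _ (by positivity)
  rw [hq, mul_pow]
  have hb : ((s + 2 * √3 / 3) / 2) ^ 2 ≤ 5 := by
    have : 0 ≤ (s + 2 * √3 / 3) / 2 := by positivity
    have : (s + 2 * √3 / 3) / 2 ≤ 2 := by linarith
    nlinarith
  calc _ ≤ (5 * η ^ 2) * 5 := mul_le_mul hsq hb (by positivity) (by positivity)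
    _ = _ := by ring

/-- planar coordinates orthogonal to a unit vector -/
lemma exists_plane {t : Fin 3 → ℝ} (ht : norm3 t = 1) :
    ∃ p q : (Fin 3 → ℝ) → ℝ, ∀ x y, p x * p y + q x * q y = dt x y - dt x t * dt y t := by
  have h1 := dt_self_of_unit ht
  unfold dt at *
  by_cases h : t 0 ^ 2 + t 1 ^ 2 = 0
  · have h0 : t 0 = 0 := by nlinarith [sq_nonneg (t 0), sq_nonneg (t 1)]
    have h0' : t 1 = 0 := by nlinarith [sq_nonneg (t 0), sq_nonneg (t 1)]
    refine ⟨fun x => x 0, fun x => x 1, fun x y => ?_⟩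
    rw [h0, h0'] at h1 ⊢
    linear_combination x 2 * y 2 * h1
  · have hp : 0 < t 0 ^ 2 + t 1 ^ 2 := lt_of_le_of_ne (by positivity) (Ne.symm h)
    have hr : √(t 0 ^ 2 + t 1 ^ 2) ^ 2 = t 0 ^ 2 + t 1 ^ 2 := Real.sq_sqrt hp.le
    have hr0 : 0 < √(t 0 ^ 2 + t 1 ^ 2) := Real.sqrt_pos.2 hp
    set ρ := √(t 0 ^ 2 + t 1 ^ 2)
    refine ⟨fun x => (t 1 * x 0 - t 0 * x 1) / ρ,
      fun x => (x 2 * (t 0 ^ 2 + t 1 ^ 2) - t 2 * (t 0 * x 0 + t 1 * x 1)) / ρ, fun x y => ?_⟩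
    have : ∀ a b c d : ℝ, a / ρ * (b / ρ) + c / ρ * (d / ρ) = (a * b + c * d) / (t 0 ^ 2 + t 1 ^ 2) := by
      intro a b c d; rw [← hr]; field_simp
    simp only [this]
    rw [div_eq_iff h]
    have h2 : t 2 ^ 2 = 1 - t 0 ^ 2 - t 1 ^ 2 := by linarith
    have e0 : t 2 * t 2 = 1 - t 0 ^ 2 - t 1 ^ 2 := by linarith
    ring_nf
    simp only [h2]
    ring

lemma cube_close {z w : ℂ} {α β γ e : ℝ} (hz : z.re * z.re + z.im * z.im = 1 - α * α)
    (hw : w.re * w.re + w.im * w.im = 1 - β * β)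
    (hzw : z.re * w.re + z.im * w.im = γ - α * β) (he : e ≤ 1 / 100)
    (hα : |α - 1 / 3| ≤ e) (hβ : |β - 1 / 3| ≤ e) (hγ : |γ + 1 / 3| ≤ e) :
    ‖z ^ 3 - w ^ 3‖ ≤ 12 * e ∧ 1 / 2 < ‖z - w‖ := by
  have he0 : 0 ≤ e := (abs_nonneg _).trans hα
  obtain ⟨a, rfl⟩ : ∃ a, α = 1 / 3 + a := ⟨α - 1 / 3, by ring⟩
  obtain ⟨b, rfl⟩ : ∃ b, β = 1 / 3 + b := ⟨β - 1 / 3, by ring⟩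
  obtain ⟨g, rfl⟩ : ∃ g, γ = -1 / 3 + g := ⟨γ + 1 / 3, by ring⟩
  have ha : |a| ≤ e := by convert hα using 2; ring
  have hb : |b| ≤ e := by convert hβ using 2; ring
  have hg : |g| ≤ e := by convert hγ using 2; ring
  have ha' := abs_le.1 ha
  have hb' := abs_le.1 hb
  have hg' := abs_le.1 hg
  have hab := abs_le.1 (show |a * b| ≤ e * e by rw [abs_mul]; gcongr)
  have haa : a * a ≤ e * e := by nlinarith
  have hbb : b * b ≤ e * e := by nlinarith
  have hee : e * e ≤ e / 100 := by nlinarith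
  have haa0 := mul_self_nonneg a
  have hbb0 := mul_self_nonneg b
  have hd : ‖z - w‖ ^ 2 = 2 - (1 / 3 + a) ^ 2 - (1 / 3 + b) ^ 2
      - 2 * (-1 / 3 + g - (1 / 3 + a) * (1 / 3 + b)) := by
    clear hab haa hbb hee haa0 hbb0
    rw [← Complex.normSq_eq_norm_sq, Complex.normSq_apply]
    simp only [Complex.sub_re, Complex.sub_im]
    linear_combination hz + hw - 2 * hzw
  have hd2 : ‖z - w‖ ^ 2 = 8 / 3 - 2 * g - a * a - b * b + 2 * (a * b) := by rw [hd]; ring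
  constructor
  · set L := 2 * (-1 / 3 + g - (1 / 3 + a) * (1 / 3 + b))
      + (2 - (1 / 3 + a) ^ 2 - (1 / 3 + b) ^ 2) / 2 with hL
    set M := (1 / 3 + b) ^ 2 - (1 / 3 + a) ^ 2 with hM
    have hLe : |L| ≤ 5 * e := by
      have hL' : L = 2 * g - (a + b) - 2 * (a * b) - (a * a + b * b) / 2 := by rw [hL]; ring
      rw [abs_le, hL']; constructor <;> linarith
    have hMe : |M| ≤ 3 * e := by
      have hM' : M = 2 / 3 * (b - a) + b * b - a * a := by rw [hM]; ring
      rw [abs_le, hM']; constructor <;> linarith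
    have hQ : ‖z ^ 2 + z * w + w ^ 2‖ ^ 2 = L ^ 2 + 3 / 4 * M ^ 2 := by
      have : ∀ A B R : ℝ, A = z.re * z.re + z.im * z.im → B = w.re * w.re + w.im * w.im →
          R = z.re * w.re + z.im * w.im → ‖z ^ 2 + z * w + w ^ 2‖ ^ 2
          = (2 * R + (A + B) / 2) ^ 2 + 3 / 4 * (A - B) ^ 2 := by
        rintro A B R rfl rfl rfl
        rw [← Complex.normSq_eq_norm_sq, Complex.normSq_apply]
        simp only [Complex.add_re, Complex.add_im, Complex.mul_re, Complex.mul_im, pow_two]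
        ring
      rw [this _ _ _ hz.symm hw.symm hzw.symm, hL, hM]; ring
    have hL2 : L ^ 2 ≤ 25 * e ^ 2 := by have := sq_le_sq' (abs_le.1 hLe).1 (abs_le.1 hLe).2; linarith
    have hM2 : M ^ 2 ≤ 9 * e ^ 2 := by have := sq_le_sq' (abs_le.1 hMe).1 (abs_le.1 hMe).2; linarith
    have hQ' : ‖z ^ 2 + z * w + w ^ 2‖ ≤ 6 * e := by
      refine pow_le_pow_iff_left₀ (norm_nonneg _) (by positivity) two_ne_zero |>.1 ?_
      rw [hQ]; linarith [sq_nonneg e]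
    have hd' : ‖z - w‖ ≤ 2 := by
      refine pow_le_pow_iff_left₀ (norm_nonneg _) (by norm_num) two_ne_zero |>.1 ?_
      rw [hd2]; linarith
    have : z ^ 3 - w ^ 3 = (z - w) * (z ^ 2 + z * w + w ^ 2) := by ring
    rw [this, norm_mul]
    calc _ ≤ 2 * (6 * e) := mul_le_mul hd' hQ' (norm_nonneg _) (by norm_num)
      _ = _ := by ring
  · apply lt_of_pow_lt_pow_left₀ 2 (norm_nonneg _)
    rw [hd2]; linarith

lemma exists_omega : ∃ ω : Fin 3 → ℂ, ∀ z w : ℂ,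
    z ^ 3 - w ^ 3 = (z - ω 0 * w) * (z - ω 1 * w) * (z - ω 2 * w) := by
  have h3 : ((√3 : ℝ) : ℂ) ^ 2 = 3 := by
    rw [← Complex.ofReal_pow, Real.sq_sqrt (by norm_num)]; norm_num
  have hI : Complex.I ^ 2 = -1 := Complex.I_sq
  refine ⟨![1, (-1 + √3 * Complex.I) / 2, (-1 - √3 * Complex.I) / 2], fun z w => ?_⟩
  simp only [Matrix.cons_val_zero, Matrix.cons_val_one, Matrix.cons_val]
  have : (√3 * Complex.I : ℂ) ^ 2 = -3 := by rw [mul_pow, h3, hI]; ring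
  linear_combination (z - w) * w ^ 2 / 4 * this

lemma coloring {V : Type} [Fintype V] (G : SimpleGraph V) [Fintype G.edgeSet] (z : V → ℂ)
    {η : ℝ} (hη : 0 ≤ η) (hm : η * G.edgeFinset.card ≤ 1 / 64)
    (h : ∀ u v, G.Adj u v → ‖z u ^ 3 - z v ^ 3‖ ≤ η ∧ 1 / 2 < ‖z u - z v‖) : G.Colorable 3 := by
  obtain ⟨ω, hω⟩ := exists_omega
  have hw : ∀ u v (p : G.Walk u v), ‖z u ^ 3 - z v ^ 3‖ ≤ η * p.length := by
    intro u v p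
    induction p with
    | nil => simp
    | cons hadj p ih =>
      rename_i a b c
      have h1 := (h _ _ hadj).1
      have := norm_sub_le_norm_sub_add_norm_sub (z a ^ 3) (z b ^ 3) (z c ^ 3)
      rw [SimpleGraph.Walk.length_cons]; push_cast
      linarith
  have hc : ∀ u, ∃ k : Fin 3, ‖z u - ω k * z (G.connectedComponentMk u).out‖ ≤ 1 / 4 := by
    intro u
    have hr : G.Reachable u (G.connectedComponentMk u).out := by
      rw [← SimpleGraph.ConnectedComponent.eq]
      exact (Quot.out_eq _).symm
    obtain ⟨p, hp⟩ := hr.exists_isPath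
    have hl : (p.length : ℝ) ≤ G.edgeFinset.card := by
      exact_mod_cast hp.isTrail.length_le_card_edgeFinset
    have h1 := (hw _ _ p).trans ((mul_le_mul_of_nonneg_left hl hη).trans hm)
    by_contra! hcon
    rw [hω, norm_mul, norm_mul] at h1
    have := mul_lt_mul'' (mul_lt_mul'' (hcon 0) (hcon 1) (by norm_num) (by norm_num)) (hcon 2)
      (by norm_num) (by norm_num)
    linarith
  choose k hk using hc
  refine ⟨SimpleGraph.Coloring.mk k ?_⟩
  intro u v hadj heq
  have h1 := hk u
  have h2 := hk v
  have hcc : G.connectedComponentMk u = G.connectedComponentMk v :=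
    SimpleGraph.ConnectedComponent.sound hadj.reachable
  rw [hcc, heq] at h1
  have h3 := (h _ _ hadj).2
  have := norm_sub_le_norm_sub_add_norm_sub (z u)
    (ω (k v) * z (G.connectedComponentMk v).out) (z v)
  rw [norm_sub_rev (ω (k v) * _) (z v)] at this
  linarith

lemma sum_mem3 {W : Type} [Fintype W] {a b : W} (hab : a ≠ b) (g : W → ℝ) :
    (∑ u, if u ∈ s(a, b) then g u else 0) = g a + g b := by
  rw [← Finset.sum_filter, ← Finset.sum_pair hab]
  congr 1
  ext u; simp

lemma sum_pairs {W : Type} [Fintype W] {a b : W} (hab : a ≠ b) (f : W → W → ℝ) :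
    (∑ u, ∑ v, if s(u, v) = s(a, b) then f u v else 0) = f a b + f b a := by
  rw [← Fintype.sum_prod_type' (f := fun u v => if s(u, v) = s(a, b) then f u v else 0)]
  rw [← Finset.sum_filter]
  rw [show f a b + f b a = ∑ p ∈ ({(a, b), (b, a)} : Finset (W × W)), f p.1 p.2 by
    rw [Finset.sum_pair]; simp [hab]]
  congr 1
  ext ⟨u, v⟩; simp

lemma sum_adj {W : Type} [Fintype W] (D : SimpleGraph W) [Fintype D.edgeSet]
    (a b : D.edgeSet → W) (hab : ∀ e : D.edgeSet, (e : Sym2 W) = s(a e, b e)) (f : W → W → ℝ) :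
    (∑ u, ∑ v, if D.Adj u v then f u v else 0) = ∑ e, (f (a e) (b e) + f (b e) (a e)) := by
  have hne : ∀ e, a e ≠ b e := by
    intro e
    have := e.2
    rw [hab e, SimpleGraph.mem_edgeSet] at this
    exact this.ne
  have : ∀ u v, (if D.Adj u v then f u v else 0) =
      ∑ e : D.edgeSet, if s(u, v) = (e : Sym2 W) then f u v else 0 := by
    intro u v
    split_ifs with h
    · rw [Finset.sum_eq_single ⟨s(u, v), h⟩]
      · simp
      · intro e _ he
        rw [if_neg]
        intro h'; apply he; ext1; exact h'.symm
      · simp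
    · symm
      apply Finset.sum_eq_zero
      intro e _
      rw [if_neg]
      intro h'; apply h
      rw [← SimpleGraph.mem_edgeSet, h']; exact e.2
  simp only [this]
  rw [Finset.sum_congr rfl fun u _ => Finset.sum_comm, Finset.sum_comm]
  apply Finset.sum_congr rfl
  intro e _
  rw [hab e]
  exact sum_pairs (hne e) f

lemma exists_ends {W : Type} (D : SimpleGraph W) : ∃ a b : D.edgeSet → W,
    ∀ e : D.edgeSet, (e : Sym2 W) = s(a e, b e) := by
  have : ∀ e : D.edgeSet, ∃ p : W × W, (e : Sym2 W) = s(p.1, p.2) := by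
    rintro ⟨e, he⟩
    induction e with | h x y => exact ⟨(x, y), rfl⟩
  choose p hp using this
  exact ⟨fun e => (p e).1, fun e => (p e).2, hp⟩

lemma ends_ne {W : Type} {D : SimpleGraph W} {a b : D.edgeSet → W}
    (hab : ∀ e : D.edgeSet, (e : Sym2 W) = s(a e, b e)) (e : D.edgeSet) : a e ≠ b e := by
  have := e.2
  rw [hab e, SimpleGraph.mem_edgeSet] at this
  exact this.ne

lemma clique_sum {V : Type} [Fintype V] (G : SimpleGraph V) [Fintype G.edgeSet]
    [Fintype (V ⊕ (G.edgeSet ⊕ G.edgeSet))]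
    (a b : G.edgeSet → V) (hab : ∀ e : G.edgeSet, (e : Sym2 V) = s(a e, b e))
    (f : (V ⊕ (G.edgeSet ⊕ G.edgeSet)) → (V ⊕ (G.edgeSet ⊕ G.edgeSet)) → ℝ)
    (hf : ∀ u v, f u v = f v u) :
    (∑ u, ∑ v, if (cliqueGadget G).Adj u v then f u v else 0) =
      2 * ∑ e, (f (.inl (a e)) (.inl (b e)) + f (.inl (a e)) (.inr (.inl e))
        + f (.inl (b e)) (.inr (.inl e)) + f (.inl (a e)) (.inr (.inr e))
        + f (.inl (b e)) (.inr (.inr e)) + f (.inr (.inl e)) (.inr (.inr e))) := by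
  have hV := sum_adj G a b hab (fun u v => f (.inl u) (.inl v))
  have hq : ∀ k : G.edgeSet → (V ⊕ (G.edgeSet ⊕ G.edgeSet)),
      (∑ u : V, ∑ e : G.edgeSet, if u ∈ (e : Sym2 V) then f (.inl u) (k e) else 0) =
      ∑ e, (f (.inl (a e)) (k e) + f (.inl (b e)) (k e)) := by
    intro k
    rw [Finset.sum_comm]
    apply Finset.sum_congr rfl
    intro e _
    rw [hab e]
    exact sum_mem3 (ends_ne hab e) (fun u => f (.inl u) (k e))
  have hq1 := hq (fun e => .inr (.inl e))
  have hq2 := hq (fun e => .inr (.inr e))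
  have hq1' := hq1
  have hq2' := hq2
  rw [Finset.sum_comm] at hq1' hq2'
  have i1 : ∀ u v, (cliqueGadget G).Adj (.inl u) (.inl v) ↔ G.Adj u v := by
    intro u v
    simp only [cliqueGadget, SimpleGraph.fromRel_adj]
    constructor
    · rintro ⟨_, h | h⟩
      exacts [h, h.symm]
    · intro h
      exact ⟨by simpa using h.ne, Or.inl h⟩
  have i2 : ∀ u e, (cliqueGadget G).Adj (.inl u) (.inr (.inl e)) ↔ u ∈ (e : Sym2 V) := by
    intro u e; simp [cliqueGadget, SimpleGraph.fromRel_adj]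
  have i3 : ∀ u e, (cliqueGadget G).Adj (.inl u) (.inr (.inr e)) ↔ u ∈ (e : Sym2 V) := by
    intro u e; simp [cliqueGadget, SimpleGraph.fromRel_adj]
  have i2' : ∀ u e, (cliqueGadget G).Adj (.inr (.inl e)) (.inl u) ↔ u ∈ (e : Sym2 V) := by
    intro u e; simp [cliqueGadget, SimpleGraph.fromRel_adj]
  have i3' : ∀ u e, (cliqueGadget G).Adj (.inr (.inr e)) (.inl u) ↔ u ∈ (e : Sym2 V) := by
    intro u e; simp [cliqueGadget, SimpleGraph.fromRel_adj]
  have i4 : ∀ e e', (cliqueGadget G).Adj (.inr (.inl e)) (.inr (.inr e')) ↔ e = e' := by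
    intro u e; simp [cliqueGadget, SimpleGraph.fromRel_adj, Subtype.ext_iff]
  have i4' : ∀ e e', (cliqueGadget G).Adj (.inr (.inr e)) (.inr (.inl e')) ↔ e = e' := by
    intro u e; simp [cliqueGadget, SimpleGraph.fromRel_adj, Subtype.ext_iff, eq_comm]
  have i5 : ∀ e e', (cliqueGadget G).Adj (.inr (.inl e)) (.inr (.inl e')) ↔ False := by
    intro u e; simp [cliqueGadget, SimpleGraph.fromRel_adj]
  have i6 : ∀ e e', (cliqueGadget G).Adj (.inr (.inr e)) (.inr (.inr e')) ↔ False := by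
    intro u e; simp [cliqueGadget, SimpleGraph.fromRel_adj]
  have hinst : (inferInstance : Fintype (V ⊕ (G.edgeSet ⊕ G.edgeSet))) = instFintypeSum _ _ :=
    Subsingleton.elim _ _
  have hs : ∀ F : (V ⊕ (G.edgeSet ⊕ G.edgeSet)) → ℝ, ∑ u, F u = ∑ u, F (.inl u) +
      (∑ e, F (.inr (.inl e)) + ∑ e, F (.inr (.inr e))) := by
    intro F
    rw [← Fintype.sum_sum_type (fun e => F (.inr e)), ← Fintype.sum_sum_type]
    congr!
  simp only [hs, i1, i2, i3, i2', i3', i4, i4', i5, i6, Finset.sum_add_distrib,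
    if_false, Finset.sum_const_zero, Finset.sum_ite_eq, Finset.mem_univ, if_true] at *
  simp only [hf (.inr (.inl _)) (.inl _), hf (.inr (.inr _)) (.inl _),
    hf (.inr (.inr _)) (.inr (.inl _)), hf (.inl (b _)) (.inl (a _))] at *
  linarith

lemma tetra_sum {V : Type} [Fintype V] (G : SimpleGraph V) [Fintype G.edgeSet]
    [Fintype (V ⊕ (G.edgeSet ⊕ G.edgeSet))] [Fintype (cliqueGadget G).edgeSet]
    [Fintype (((V ⊕ (G.edgeSet ⊕ G.edgeSet)) ⊕ (cliqueGadget G).edgeSet) ⊕ Unit)]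
    (a b : (cliqueGadget G).edgeSet → (V ⊕ (G.edgeSet ⊕ G.edgeSet)))
    (hab : ∀ e : (cliqueGadget G).edgeSet, (e : Sym2 _) = s(a e, b e))
    (f : (((V ⊕ (G.edgeSet ⊕ G.edgeSet)) ⊕ (cliqueGadget G).edgeSet) ⊕ Unit) →
      (((V ⊕ (G.edgeSet ⊕ G.edgeSet)) ⊕ (cliqueGadget G).edgeSet) ⊕ Unit) → ℝ)
    (hf : ∀ u v, f u v = f v u) :
    (∑ u, ∑ v, if (tetraGadget G).Adj u v then f u v else 0) =
      2 * ∑ e, (f (.inl (.inl (a e))) (.inl (.inl (b e))) +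
        (f (.inl (.inl (a e))) (.inl (.inr e)) + f (.inl (.inl (b e))) (.inl (.inr e))))
      + 2 * ∑ e : G.edgeSet, f (.inl (.inl (.inr (.inr e)))) (.inr ()) := by
  have hW := sum_adj (cliqueGadget G) a b hab (fun u v => f (.inl (.inl u)) (.inl (.inl v)))
  have hq : (∑ u, ∑ e : (cliqueGadget G).edgeSet,
      if u ∈ (e : Sym2 _) then f (.inl (.inl u)) (.inl (.inr e)) else 0) =
      ∑ e, (f (.inl (.inl (a e))) (.inl (.inr e)) + f (.inl (.inl (b e))) (.inl (.inr e))) := by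
    rw [Finset.sum_comm]
    apply Finset.sum_congr rfl
    intro e _
    rw [hab e]
    convert sum_mem3 (ends_ne hab e) (fun u => f (.inl (.inl u)) (.inl (.inr e)))
  have hq' := hq
  rw [Finset.sum_comm] at hq'
  have i1 : ∀ u v, (tetraGadget G).Adj (.inl (.inl u)) (.inl (.inl v)) ↔
      (cliqueGadget G).Adj u v := by
    intro u v
    simp only [tetraGadget, SimpleGraph.fromRel_adj]
    constructor
    · rintro ⟨_, h | h⟩
      exacts [h, h.symm]
    · intro h
      exact ⟨by simpa using h.ne, Or.inl h⟩
  have i2 : ∀ u e, (tetraGadget G).Adj (.inl (.inl u)) (.inl (.inr e)) ↔ u ∈ (e : Sym2 _) := by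
    intro u e; simp [tetraGadget, SimpleGraph.fromRel_adj]
  have i2' : ∀ u e, (tetraGadget G).Adj (.inl (.inr e)) (.inl (.inl u)) ↔ u ∈ (e : Sym2 _) := by
    intro u e; simp [tetraGadget, SimpleGraph.fromRel_adj]
  have i3 : ∀ e e', (tetraGadget G).Adj (.inl (.inr e)) (.inl (.inr e')) ↔ False := by
    intro u e; simp [tetraGadget, SimpleGraph.fromRel_adj]
  have i4 : ∀ e k, (tetraGadget G).Adj (.inl (.inr e)) (.inr k) ↔ False := by
    intro u e; simp [tetraGadget, SimpleGraph.fromRel_adj]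
  have i4' : ∀ e k, (tetraGadget G).Adj (.inr k) (.inl (.inr e)) ↔ False := by
    intro u e; simp [tetraGadget, SimpleGraph.fromRel_adj]
  have i5 : ∀ k l, (tetraGadget G).Adj (.inr k) (.inr l) ↔ False := by
    intro u e; simp [tetraGadget, SimpleGraph.fromRel_adj]
  have i6 : ∀ u k, (tetraGadget G).Adj (.inl (.inl (.inl u))) (.inr k) ↔ False := by
    intro u e; simp [tetraGadget, SimpleGraph.fromRel_adj]
  have i6' : ∀ u k, (tetraGadget G).Adj (.inr k) (.inl (.inl (.inl u))) ↔ False := by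
    intro u e; simp [tetraGadget, SimpleGraph.fromRel_adj]
  have i7 : ∀ u k, (tetraGadget G).Adj (.inl (.inl (.inr (.inl u)))) (.inr k) ↔ False := by
    intro u e; simp [tetraGadget, SimpleGraph.fromRel_adj]
  have i7' : ∀ u k, (tetraGadget G).Adj (.inr k) (.inl (.inl (.inr (.inl u)))) ↔ False := by
    intro u e; simp [tetraGadget, SimpleGraph.fromRel_adj]
  have i8 : ∀ u k, (tetraGadget G).Adj (.inl (.inl (.inr (.inr u)))) (.inr k) ↔ True := by
    intro u e; simp [tetraGadget, SimpleGraph.fromRel_adj]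
  have i8' : ∀ u k, (tetraGadget G).Adj (.inr k) (.inl (.inl (.inr (.inr u)))) ↔ True := by
    intro u e; simp [tetraGadget, SimpleGraph.fromRel_adj]
  have hs0 : ∀ F : (V ⊕ (G.edgeSet ⊕ G.edgeSet)) → ℝ, ∑ u, F u = ∑ u, F (.inl u) +
      (∑ e, F (.inr (.inl e)) + ∑ e, F (.inr (.inr e))) := by
    intro F
    rw [← Fintype.sum_sum_type (fun e => F (.inr e)), ← Fintype.sum_sum_type]
    congr!
  have hs : ∀ F : (((V ⊕ (G.edgeSet ⊕ G.edgeSet)) ⊕ (cliqueGadget G).edgeSet) ⊕ Unit) → ℝ,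
      ∑ u, F u = ∑ u, F (.inl (.inl u)) + ∑ e, F (.inl (.inr e)) + F (.inr ()) := by
    intro F
    rw [← Fintype.sum_sum_type (fun e => F (.inl e)),
      show F (.inr ()) = ∑ k : Unit, F (.inr k) by simp, ← Fintype.sum_sum_type]
    congr!
  have hk : (∑ u, if (tetraGadget G).Adj (.inl (.inl u)) (.inr ()) then
      f (.inl (.inl u)) (.inr ()) else 0) =
      ∑ e : G.edgeSet, f (.inl (.inl (.inr (.inr e)))) (.inr ()) := by
    rw [hs0]; simp [i6, i7, i8]
  have hk' : (∑ u, if (tetraGadget G).Adj (.inr ()) (.inl (.inl u)) then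
      f (.inr ()) (.inl (.inl u)) else 0) =
      ∑ e : G.edgeSet, f (.inl (.inl (.inr (.inr e)))) (.inr ()) := by
    rw [hs0]; simp [i6', i7', i8', hf (.inr ())]
  simp only [hs, i1, i2, i2', i3, i4, i4', i5, Finset.sum_add_distrib, hk, hk',
    if_false, Finset.sum_const_zero] at *
  simp only [hf (.inl (.inr _)) (.inl (.inl _)),
    hf (.inl (.inl (b _))) (.inl (.inl (a _)))] at *
  linarith

/-- upper bound on the objective -/
lemma value_le {V : Type} [Fintype V] (G : SimpleGraph V) [Fintype G.edgeSet]
    [Fintype (((V ⊕ (G.edgeSet ⊕ G.edgeSet)) ⊕ (cliqueGadget G).edgeSet) ⊕ Unit)]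
    (a b : G.edgeSet → V) (hab : ∀ e : G.edgeSet, (e : Sym2 V) = s(a e, b e))
    (x : (((V ⊕ (G.edgeSet ⊕ G.edgeSet)) ⊕ (cliqueGadget G).edgeSet) ⊕ Unit) → Fin 3 → ℝ)
    (hx : ∀ u, norm3 (x u) = 1) :
    (1 / 8) * (∑ u, ∑ v, if (tetraGadget G).Adj u v then norm3 (x u - x v) ^ 2 else 0) ≤
      ∑ e : G.edgeSet, (1 / 4) * (
        40 + 8 * √3
        - √3 / 2 * ((norm3 (x (.inl (.inl (.inl (a e)))) + x (.inl (.inl (.inl (b e))))) - 2 * √3 / 3) ^ 2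
          + (norm3 (x (.inl (.inl (.inl (a e)))) + x (.inl (.inl (.inr (.inr e))))) - 2 * √3 / 3) ^ 2
          + (norm3 (x (.inl (.inl (.inl (b e)))) + x (.inl (.inl (.inr (.inr e))))) - 2 * √3 / 3) ^ 2)
        + norm3 (x (.inl (.inl (.inr (.inr e)))) - x (.inr ())) ^ 2) := by
  obtain ⟨p, q, hpq⟩ := exists_ends (cliqueGadget G)
  have : Fintype (cliqueGadget G).edgeSet := Fintype.ofFinite _
  rw [tetra_sum G p q hpq (fun u v => norm3 (x u - x v) ^ 2)
    (fun u v => by simp only [norm3_sub_comm])]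
  have h1 : ∑ e, (norm3 (x (.inl (.inl (p e))) - x (.inl (.inl (q e)))) ^ 2 +
        (norm3 (x (.inl (.inl (p e))) - x (.inl (.inr e))) ^ 2
          + norm3 (x (.inl (.inl (q e))) - x (.inl (.inr e))) ^ 2)) ≤
      ∑ e, psi (x (.inl (.inl (p e)))) (x (.inl (.inl (q e)))) := by
    apply Finset.sum_le_sum
    intro e _
    have := tri_le (hx (.inl (.inl (p e)))) (hx (.inl (.inl (q e)))) (hx (.inl (.inr e)))
    unfold psi; linarith
  have h2 := sum_adj (cliqueGadget G) p q hpq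
    (fun u v => psi (x (.inl (.inl u))) (x (.inl (.inl v))))
  rw [clique_sum G a b hab _ (fun u v => psi_comm _ _)] at h2
  simp only [psi_comm (x (.inl (.inl (q _)))), ← two_mul] at h2
  rw [← Finset.mul_sum] at h2
  have h3 := mul_left_cancel₀ two_ne_zero h2
  rw [← h3] at h1
  rw [← Finset.mul_sum, Finset.sum_add_distrib (s := (Finset.univ : Finset G.edgeSet))]
  have h4 := Finset.sum_le_sum (s := Finset.univ) fun (e : G.edgeSet) _ =>
    le_sub_iff_add_le.2 (gadget (hx (.inl (.inl (.inl (a e))))) (hx (.inl (.inl (.inl (b e)))))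
      (hx (.inl (.inl (.inr (.inl e))))) (hx (.inl (.inl (.inr (.inr e))))))
  linarith

lemma edge_close {a b τ t : Fin 3 → ℝ} (ha : norm3 a = 1) (hb : norm3 b = 1)
    (hτ : norm3 τ = 1) (ht : norm3 t = 1) {η : ℝ} (hη : 0 ≤ η)
    (h : 11 + 2 * √3 - η ^ 2 ≤ (1 / 4) * (40 + 8 * √3
        - √3 / 2 * ((norm3 (a + b) - 2 * √3 / 3) ^ 2
          + (norm3 (a + τ) - 2 * √3 / 3) ^ 2
          + (norm3 (b + τ) - 2 * √3 / 3) ^ 2)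
        + norm3 (τ - t) ^ 2)) :
    |dt a b + 1 / 3| ≤ 7 * η ∧ |dt a t - 1 / 3| ≤ 7 * η ∧ |dt b t - 1 / 3| ≤ 7 * η := by
  have e1 := sub_sq3 τ t
  have e2 := add_sq3 τ t
  rw [dt_self_of_unit hτ, dt_self_of_unit ht] at e1 e2
  have q0 := sq_nonneg (norm3 (τ + t))
  have q1 : 0 ≤ √3 / 2 * (norm3 (a + b) - 2 * √3 / 3) ^ 2 := by positivity
  have q2 : 0 ≤ √3 / 2 * (norm3 (a + τ) - 2 * √3 / 3) ^ 2 := by positivity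
  have q3 : 0 ≤ √3 / 2 * (norm3 (b + τ) - 2 * √3 / 3) ^ 2 := by positivity
  have c1 := dot_close ha hb hη (by linarith)
  have c2 := dot_close ha hτ hη (by linarith)
  have c3 := dot_close hb hτ hη (by linarith)
  have hn : norm3 (τ + t) ≤ 2 * η := by
    refine pow_le_pow_iff_left₀ (norm3_nonneg _) (by positivity) two_ne_zero |>.1 ?_
    linarith
  have key : ∀ y, norm3 y = 1 → |dt y τ + 1 / 3| ≤ 5 * η → |dt y t - 1 / 3| ≤ 7 * η := by
    intro y hy h5
    have h6 := (abs_dt_le hy (τ + t)).trans hn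
    have h7 : dt y (τ + t) = dt y τ + dt y t := by simp only [dt, Pi.add_apply]; ring
    rw [h7] at h6
    rw [abs_le] at *
    constructor <;> linarith
  exact ⟨c1.trans (by linarith), key a ha c2, key b hb c3⟩

/-- There is a constant `c > 0` such that whenever `MC₃(H'') ≥ (10 + 2√3)·m + m - c/m²`
(with `m ≥ 1`), the graph `G` is 3-colorable. -/
theorem stmt19 :
    ∃ c : ℝ, c > 0 ∧
      ∀ (V : Type) [Fintype V] [DecidableEq V] (G : SimpleGraph V)
        [DecidableRel G.Adj],
        1 ≤ G.edgeFinset.card →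
        mc3 (tetraGadget G) ≥
          (10 + 2 * Real.sqrt 3) * (G.edgeFinset.card : ℝ) + (G.edgeFinset.card : ℝ) -
            c / (G.edgeFinset.card : ℝ) ^ 2 →
        G.Colorable 3 := by
  refine ⟨5 / 10 ^ 9, by norm_num, ?_⟩
  intro V _ _ G _ hm hmc
  set m := G.edgeFinset.card with hmdef
  have hm1 : (1 : ℝ) ≤ m := by exact_mod_cast hm
  have hm0 : (0 : ℝ) < m := by linarith
  unfold mc3 at hmc
  have hlt := lt_of_lt_of_le (sub_lt_self _ (show (0 : ℝ) < 5 / 10 ^ 9 / (m : ℝ) ^ 2 by positivity)) hmc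
  obtain ⟨_, ⟨x, hx, rfl⟩, hval⟩ := exists_lt_of_lt_csSup
    (by exact ⟨_, fun _ => ![1, 0, 0], fun _ => by simp [norm3, Fin.sum_univ_three], rfl⟩) hlt
  obtain ⟨a, b, hab⟩ := exists_ends G
  have hle := value_le G a b hab x hx
  set η : ℝ := 1 / 10 ^ 4 / m with hη
  have hη0 : 0 ≤ η := by positivity
  have hη2 : η ^ 2 = 5 / 10 ^ 9 / (m : ℝ) ^ 2 + 5 / 10 ^ 9 / (m : ℝ) ^ 2 := by
    rw [hη]; field_simp; norm_num
  have hcard : (Finset.univ : Finset G.edgeSet).card = m := by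
    rw [hmdef, SimpleGraph.edgeFinset_card, Finset.card_univ]
  set F : G.edgeSet → ℝ := fun e => (1 / 4) * (
        40 + 8 * √3
        - √3 / 2 * ((norm3 (x (.inl (.inl (.inl (a e)))) + x (.inl (.inl (.inl (b e))))) - 2 * √3 / 3) ^ 2
          + (norm3 (x (.inl (.inl (.inl (a e)))) + x (.inl (.inl (.inr (.inr e))))) - 2 * √3 / 3) ^ 2
          + (norm3 (x (.inl (.inl (.inl (b e)))) + x (.inl (.inl (.inr (.inr e))))) - 2 * √3 / 3) ^ 2)
        + norm3 (x (.inl (.inl (.inr (.inr e)))) - x (.inr ())) ^ 2) with hF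
  have hFle : ∀ e, F e ≤ 11 + 2 * √3 := by
    intro e
    have e1 := sub_sq3 (x (.inl (.inl (.inr (.inr e))))) (x (.inr ()))
    have e2 := add_sq3 (x (.inl (.inl (.inr (.inr e))))) (x (.inr ()))
    rw [dt_self_of_unit (hx _), dt_self_of_unit (hx _)] at e1 e2
    have q0 := sq_nonneg (norm3 (x (.inl (.inl (.inr (.inr e)))) + x (.inr ())))
    have q1 : 0 ≤ √3 / 2 * ((norm3 (x (.inl (.inl (.inl (a e)))) + x (.inl (.inl (.inl (b e))))) - 2 * √3 / 3) ^ 2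
          + (norm3 (x (.inl (.inl (.inl (a e)))) + x (.inl (.inl (.inr (.inr e))))) - 2 * √3 / 3) ^ 2
          + (norm3 (x (.inl (.inl (.inl (b e)))) + x (.inl (.inl (.inr (.inr e))))) - 2 * √3 / 3) ^ 2) := by
      positivity
    simp only [hF]
    linarith
  have hsum : (m : ℝ) * (11 + 2 * √3) - η ^ 2 < ∑ e, F e := by
    refine lt_of_lt_of_le ?_ hle
    refine lt_of_eq_of_lt ?_ hval
    rw [hη2]; ring
  have hFge : ∀ e, 11 + 2 * √3 - η ^ 2 ≤ F e := by
    intro e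
    have h1 := Finset.single_le_sum (s := Finset.univ) (f := fun e => 11 + 2 * √3 - F e)
      (fun e _ => sub_nonneg.2 (hFle e)) (Finset.mem_univ e)
    rw [Finset.sum_sub_distrib, Finset.sum_const, hcard, nsmul_eq_mul] at h1
    linarith
  obtain ⟨p, q, hpq⟩ := exists_plane (hx (.inr ()))
  set X : V → Fin 3 → ℝ := fun v => x (.inl (.inl (.inl v))) with hX
  have hcl : ∀ e, |dt (X (a e)) (X (b e)) + 1 / 3| ≤ 7 * η ∧
      |dt (X (a e)) (x (.inr ())) - 1 / 3| ≤ 7 * η ∧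
      |dt (X (b e)) (x (.inr ())) - 1 / 3| ≤ 7 * η :=
    fun e => edge_close (hx _) (hx _) (hx _) (hx _) hη0 (hFge e)
  have hηle : 7 * η ≤ 1 / 100 := by
    have : η ≤ 1 / 10 ^ 4 := by
      rw [hη]; exact div_le_self (by norm_num) hm1
    linarith
  refine coloring G (fun v => ⟨p (X v), q (X v)⟩) (η := 12 * (7 * η)) (by positivity) ?_ ?_
  · rw [← hmdef, hη]
    have : 12 * (7 * (1 / 10 ^ 4 / (m : ℝ))) * m = 84 / 10 ^ 4 := by field_simp; norm_num
    rw [this]; norm_num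
  · intro u v huv
    have hcl2 : |dt (X u) (X v) + 1 / 3| ≤ 7 * η ∧
      |dt (X u) (x (.inr ())) - 1 / 3| ≤ 7 * η ∧ |dt (X v) (x (.inr ())) - 1 / 3| ≤ 7 * η := by
      have h1 := hcl ⟨s(u, v), huv⟩
      have h2 := hab ⟨s(u, v), huv⟩
      simp only [Sym2.eq_iff] at h2
      rcases h2 with ⟨h3, h4⟩ | ⟨h3, h4⟩
      · rw [← h3, ← h4] at h1; exact h1
      · rw [← h3, ← h4, dt_comm (X v) (X u)] at h1; exact ⟨h1.1, h1.2.2, h1.2.1⟩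
    have hu := hpq (X u) (X u)
    have hv := hpq (X v) (X v)
    rw [dt_self_of_unit (hx _)] at hu hv
    exact cube_close hu hv (hpq (X u) (X v)) hηle hcl2.2.1 hcl2.2.2 hcl2.1
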